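/- For every natural number m, the k-vector space S_m, defined as the image in S = S(a,b,c) of the span of all words of length m in the generators x, y, z, has dimension dim_k S_m = (m+1)(m+2)/2; that is, S has the Hilbert series (1−t)^{−3} of a polynomial ring in three variables. -/

import Mathlib

noncomputable section

/-- The defining relations of the 3-dimensional Sklyanin algebra `S(a,b,c)`:
`a·yz + b·zy + c·x²`, `a·zx + b·xz + c·y²`, `a·xy + b·yx + c·z²` are set to zero.
The generators `x, y, z` are the images of `FreeAlgebra.ι k 0, 1, 2`. -/
inductive SklyaninRel (k : Type*) [CommRing k] (a b c : k) :
    FreeAlgebra k (Fin 3) → FreeAlgebra k (Fin 3) → Prop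
  | r1 : SklyaninRel k a b c
      (a • (FreeAlgebra.ι k 1 * FreeAlgebra.ι k 2) + b • (FreeAlgebra.ι k 2 * FreeAlgebra.ι k 1)
        + c • (FreeAlgebra.ι k 0 * FreeAlgebra.ι k 0)) 0
  | r2 : SklyaninRel k a b c
      (a • (FreeAlgebra.ι k 2 * FreeAlgebra.ι k 0) + b • (FreeAlgebra.ι k 0 * FreeAlgebra.ι k 2)
        + c • (FreeAlgebra.ι k 1 * FreeAlgebra.ι k 1)) 0
  | r3 : SklyaninRel k a b c
      (a • (FreeAlgebra.ι k 0 * FreeAlgebra.ι k 1) + b • (FreeAlgebra.ι k 1 * FreeAlgebra.ι k 0)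
        + c • (FreeAlgebra.ι k 2 * FreeAlgebra.ι k 2)) 0

/-- The 3-dimensional Sklyanin algebra `S(a,b,c)`: the quotient of the free algebra
`k⟨x,y,z⟩` by the two-sided ideal generated by the three Sklyanin relations. -/
def Sklyanin (k : Type*) [CommRing k] (a b c : k) : Type _ := RingQuot (SklyaninRel k a b c)

instance (k : Type*) [CommRing k] (a b c : k) : Ring (Sklyanin k a b c) := by
  unfold Sklyanin; infer_instance

instance (k : Type*) [CommRing k] (a b c : k) : Algebra k (Sklyanin k a b c) := by
  unfold Sklyanin; infer_instance

namespace Sklyanin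

variable (k : Type*) [CommRing k] (a b c : k)

/-- The generator `x` of `S(a,b,c)`. -/
def X : Sklyanin k a b c := RingQuot.mkAlgHom k (SklyaninRel k a b c) (FreeAlgebra.ι k 0)
/-- The generator `y` of `S(a,b,c)`. -/
def Y : Sklyanin k a b c := RingQuot.mkAlgHom k (SklyaninRel k a b c) (FreeAlgebra.ι k 1)
/-- The generator `z` of `S(a,b,c)`. -/
def Z : Sklyanin k a b c := RingQuot.mkAlgHom k (SklyaninRel k a b c) (FreeAlgebra.ι k 2)

/-- The canonical central element
`g = c(c³−b³)y³ + b(c³−a³)yxz + a(b³−c³)xyz + c(a³−c³)x³` of `S(a,b,c)`. -/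
def g : Sklyanin k a b c :=
  (c * (c ^ 3 - b ^ 3)) • (Y k a b c * Y k a b c * Y k a b c)
    + (b * (c ^ 3 - a ^ 3)) • (Y k a b c * X k a b c * Z k a b c)
    + (a * (b ^ 3 - c ^ 3)) • (X k a b c * Y k a b c * Z k a b c)
    + (c * (a ^ 3 - c ^ 3)) • (X k a b c * X k a b c * X k a b c)

end Sklyanin


/-- The generators of the Sklyanin algebra, as a function `Fin 3 → S(a,b,c)`. -/
def Sklyanin.gen (k : Type*) [CommRing k] (a b c : k) : Fin 3 → Sklyanin k a b c :=
  fun i => RingQuot.mkAlgHom k (SklyaninRel k a b c) (FreeAlgebra.ι k i)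

/-- The degree-`m` component of `S(a,b,c)`: the `k`-span of the images of all words of
length `m` in the generators `x, y, z`. -/
def Sklyanin.degComponent (k : Type*) [CommRing k] (a b c : k) (m : ℕ) :
    Submodule k (Sklyanin k a b c) :=
  Submodule.span k
    {s : Sklyanin k a b c |
      ∃ w : Fin m → Fin 3, s = (List.ofFn fun j => Sklyanin.gen k a b c (w j)).prod}

section Rank

open Module

variable {k M N : Type*} [Field k] [AddCommGroup M] [Module k M] [AddCommGroup N] [Module k N]

theorem Submodule.finrank_prod (p : Submodule k M) (q : Submodule k N) [FiniteDimensional k p]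
    [FiniteDimensional k q] : finrank k (p.prod q) = finrank k p + finrank k q := by
  have h : p.prod q = LinearMap.range (p.subtype.prodMap q.subtype) := by
    rw [LinearMap.range_prodMap, p.range_subtype, q.range_subtype]
  rw [h, LinearMap.finrank_range_of_inj, Module.finrank_prod]
  exact Prod.map_injective.2 ⟨p.subtype_injective, q.subtype_injective⟩

instance Submodule.finiteDimensional_prod (p : Submodule k M) (q : Submodule k N)
    [FiniteDimensional k p] [FiniteDimensional k q] : FiniteDimensional k (p.prod q) :=
  Module.Finite.iff_fg.2 ((Module.Finite.iff_fg.1 ‹_›).prod (Module.Finite.iff_fg.1 ‹_›))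

theorem Submodule.finrank_map_add_finrank_inf_ker (f : M →ₗ[k] N) (p : Submodule k M)
    [FiniteDimensional k p] :
    finrank k (p.map f) + finrank k (p ⊓ LinearMap.ker f : Submodule k M) = finrank k p := by
  rw [← (f.domRestrict p).finrank_range_add_finrank_ker, LinearMap.range_domRestrict,
    LinearMap.ker_domRestrict]
  congr 1
  rw [← Submodule.map_comap_subtype]
  exact (Submodule.equivSubtypeMap p _).finrank_eq.symm

theorem Submodule.finrank_map_of_forall {f : M →ₗ[k] N} {p : Submodule k M}
    [FiniteDimensional k p] (h : ∀ w ∈ p, f w = 0 → w = 0) :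
    finrank k (p.map f) = finrank k p := by
  rw [← Submodule.finrank_map_add_finrank_inf_ker f p, (Submodule.eq_bot_iff _).2
    fun w (hw : w ∈ p ⊓ LinearMap.ker f) => h w hw.1 hw.2, finrank_bot, add_zero]

end Rank

section LinearAlgebra

open Matrix

variable {k : Type*} [Field k] {a b c : k}

/-- The coefficient matrix of the combination of the Sklyanin relations with coefficients `α`. -/
def relMatrix (a b c : k) (α : Fin 3 → k) : Matrix (Fin 3) (Fin 3) k :=
  !![c * α 0, a * α 2, b * α 1; b * α 2, c * α 1, a * α 0; a * α 1, b * α 0, c * α 2]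

theorem vecMul_relMatrix (q α : Fin 3 → k) :
    q ᵥ* relMatrix a b c α = α ᵥ* relMatrix b a c q := by
  ext i
  fin_cases i <;> simp [relMatrix, vecMul, dotProduct, Fin.sum_univ_three] <;> ring

theorem relMatrix_mulVec (p q : Fin 3 → k) :
    relMatrix b a c q *ᵥ p = relMatrix a b c p *ᵥ q := by
  ext i
  fin_cases i <;> simp [relMatrix, mulVec, dotProduct, Fin.sum_univ_three] <;> ring

theorem det_relMatrix (q : Fin 3 → k) : (relMatrix a b c q).det =
    (a ^ 3 + b ^ 3 + c ^ 3) * (q 0 * q 1 * q 2) - a * b * c * (q 0 ^ 3 + q 1 ^ 3 + q 2 ^ 3) := by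
  rw [det_fin_three]
  simp [relMatrix]
  ring

theorem det_relMatrix_swap (q : Fin 3 → k) :
    (relMatrix a b c q).det = (relMatrix b a c q).det := by
  rw [det_relMatrix, det_relMatrix]
  ring

theorem relMatrix_ne_vecMulVec (ha : a ≠ 0) (hb : b ≠ 0)
    (habc : ¬(a ^ 3 = b ^ 3 ∧ b ^ 3 = c ^ 3)) {α : Fin 3 → k} (hα : α ≠ 0) (l v : Fin 3 → k) :
    relMatrix a b c α ≠ vecMulVec l v := by
  intro h
  have e : ∀ i j, relMatrix a b c α i j = l i * v j := fun i j => by rw [h, vecMulVec_apply]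
  have e00 := e 0 0
  have e01 := e 0 1
  have e02 := e 0 2
  have e10 := e 1 0
  have e11 := e 1 1
  have e12 := e 1 2
  have e20 := e 2 0
  have e21 := e 2 1
  have e22 := e 2 2
  simp [relMatrix] at e00 e01 e02 e10 e11 e12 e20 e21 e22
  have f1 : c ^ 2 * (α 0 * α 1) = a * b * α 2 ^ 2 := by
    linear_combination c * α 1 * e00 + l 0 * v 0 * e11 - b * α 2 * e01 - l 0 * v 1 * e10
  have f2 : c ^ 2 * (α 1 * α 2) = a * b * α 0 ^ 2 := by
    linear_combination c * α 2 * e11 + l 1 * v 1 * e22 - b * α 0 * e12 - l 1 * v 2 * e21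
  have f3 : c ^ 2 * (α 0 * α 2) = a * b * α 1 ^ 2 := by
    linear_combination c * α 2 * e00 + l 0 * v 0 * e22 - a * α 1 * e02 - l 0 * v 2 * e20
  have g1 : a * c * α 0 ^ 2 = b ^ 2 * (α 1 * α 2) := by
    linear_combination a * α 0 * e00 + l 0 * v 0 * e12 - b * α 2 * e02 - l 0 * v 2 * e10
  have hab : a * b ≠ 0 := mul_ne_zero ha hb
  have h0 : α 0 ≠ 0 := by
    intro h0
    refine hα (funext fun i => ?_)
    fin_cases i
    · exact h0
    · simpa [h0, hab, ha, hb] using f3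
    · simpa [h0, hab, ha, hb] using f1
  have h1 : α 1 ≠ 0 := by
    intro h1
    exact h0 (by simpa [h1, ha, hb] using f2)
  have h2 : α 2 ≠ 0 := by
    intro h2
    exact h0 (by simpa [h2, ha, hb] using f2)
  have g2 : a ^ 2 * (α 0 * α 1) = b * c * α 2 ^ 2 := by
    linear_combination a * α 1 * e12 + l 1 * v 2 * e20 - b * α 2 * e22 - l 2 * v 2 * e10
  have hcb : b ^ 3 = c ^ 3 := mul_right_cancel₀ (mul_ne_zero h1 h2)
    (by linear_combination -(b * g1) - c * f2)
  have hca : a ^ 3 = c ^ 3 := mul_right_cancel₀ (mul_ne_zero h0 h1)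
    (by linear_combination a * g2 - c * f1)
  exact habc ⟨hca.trans hcb.symm, hcb⟩

/-- The linear forms vanishing at the point `q`. -/
def orth (q : Fin 3 → k) : Submodule k (Fin 3 → k) := LinearMap.ker (Fintype.linearCombination k q)

theorem mem_orth {q v : Fin 3 → k} : v ∈ orth q ↔ v ⬝ᵥ q = 0 := Iff.rfl

theorem mem_orth_comm {q v : Fin 3 → k} : v ∈ orth q ↔ q ∈ orth v := by
  rw [mem_orth, mem_orth, dotProduct_comm]

theorem finrank_orth {q : Fin 3 → k} (hq : q ≠ 0) : Module.finrank k (orth q) = 2 := by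
  obtain ⟨i, hi⟩ := Function.ne_iff.1 hq
  have hsurj : Function.Surjective (Fintype.linearCombination k q) := fun r =>
    ⟨Pi.single i (r / q i), by
      rw [Fintype.linearCombination_apply_single, smul_eq_mul, div_mul_cancel₀ _ hi]⟩
  have h := (Fintype.linearCombination k q).finrank_range_add_finrank_ker
  rw [LinearMap.range_eq_top.2 hsurj, finrank_top, Module.finrank_self, Module.finrank_fin_fun] at h
  unfold orth
  omega

theorem exists_span_pair_eq_orth {l q : Fin 3 → k} (hl : l ≠ 0) (hq : q ≠ 0) (hlq : l ∈ orth q) :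
    ∃ l', orth q = Submodule.span k {l, l'} := by
  have hlt : Submodule.span k {l} < orth q := by
    refine lt_of_le_of_ne (by simpa using hlq) fun h => ?_
    have := finrank_orth hq
    rw [← h, finrank_span_singleton hl] at this
    omega
  obtain ⟨l', hl', hn⟩ := SetLike.exists_of_lt hlt
  refine ⟨l', (Submodule.eq_of_le_of_finrank_le ?_ ?_).symm⟩
  · rw [Submodule.span_le]
    rintro _ (rfl | rfl) <;> assumption
  · have hlt' : Submodule.span k {l} < Submodule.span k {l, l'} := by
      refine lt_of_le_of_ne (Submodule.span_mono (by simp)) fun h => hn ?_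
      rw [h]
      exact Submodule.subset_span (by simp)
    have := Submodule.finrank_lt_finrank_of_lt hlt'
    rw [finrank_span_singleton hl] at this
    rw [finrank_orth hq]
    omega

/-- Every line meets the point scheme. -/
theorem exists_det_relMatrix_eq_zero [IsAlgClosed k] {l : Fin 3 → k} (hl : l ≠ 0) :
    ∃ q, q ≠ 0 ∧ l ∈ orth q ∧ (relMatrix b a c q).det = 0 := by
  obtain ⟨e, he, he0⟩ : ∃ e ∈ orth l, e ≠ 0 := by
    refine (Submodule.ne_bot_iff _).1 fun h => ?_
    have := finrank_orth hl
    rw [h, finrank_bot] at this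
    omega
  obtain ⟨f, hf⟩ := exists_span_pair_eq_orth he0 hl he
  have hfl : f ∈ orth l := hf ▸ Submodule.subset_span (by simp)
  have hfe : ∀ t : k, f + t • e ≠ 0 := by
    intro t h
    have h2 : orth l = Submodule.span k {e} := by
      rw [hf]
      refine le_antisymm (Submodule.span_le.2 ?_) (Submodule.span_mono (by simp))
      rintro _ (rfl | rfl)
      · exact Submodule.subset_span rfl
      · exact Submodule.mem_span_singleton.2 ⟨-t, by
          rw [neg_smul]; exact (eq_neg_of_add_eq_zero_left h).symm⟩
    have := finrank_orth hl
    rw [h2, finrank_span_singleton he0] at this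
    omega
  by_cases hdet : (relMatrix b a c e).det = 0
  · exact ⟨e, he0, mem_orth_comm.1 he, hdet⟩
  let D : Cubic k := ⟨(relMatrix b a c e).det,
    (b ^ 3 + a ^ 3 + c ^ 3) * (e 0 * e 1 * f 2 + e 0 * f 1 * e 2 + f 0 * e 1 * e 2) -
      3 * (b * a * c) * (e 0 ^ 2 * f 0 + e 1 ^ 2 * f 1 + e 2 ^ 2 * f 2),
    (b ^ 3 + a ^ 3 + c ^ 3) * (e 0 * f 1 * f 2 + f 0 * e 1 * f 2 + f 0 * f 1 * e 2) -
      3 * (b * a * c) * (e 0 * f 0 ^ 2 + e 1 * f 1 ^ 2 + e 2 * f 2 ^ 2),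
    (relMatrix b a c f).det⟩
  obtain ⟨t, ht⟩ := IsAlgClosed.exists_root D.toPoly (by
    rw [Cubic.degree_of_a_ne_zero hdet]; norm_num)
  refine ⟨f + t • e, hfe t, mem_orth_comm.1 (add_mem hfl (Submodule.smul_mem _ t he)), ?_⟩
  simp only [Polynomial.IsRoot, Cubic.toPoly, D, Polynomial.eval_add, Polynomial.eval_mul,
    Polynomial.eval_C, Polynomial.eval_pow, Polynomial.eval_X, det_relMatrix] at ht
  simp only [det_relMatrix, Pi.add_apply, Pi.smul_apply, smul_eq_mul]
  linear_combination ht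

section Nondegenerate

variable (ha : a ≠ 0) (hb : b ≠ 0) (habc : ¬(a ^ 3 = b ^ 3 ∧ b ^ 3 = c ^ 3))

include ha hb habc

theorem two_le_finrank_range_vecMulLinear {q : Fin 3 → k} (hq : q ≠ 0) :
    2 ≤ Module.finrank k (LinearMap.range (relMatrix a b c q).vecMulLinear) := by
  by_contra! hlt
  obtain ⟨⟨v, _⟩, hv⟩ := finrank_le_one_iff.1 (Nat.le_of_lt_succ hlt)
  have hrow : ∀ i, ∃ r : k, r • v = relMatrix a b c q i := fun i => by
    obtain ⟨r, hr⟩ := hv ⟨relMatrix a b c q i, Pi.single i 1, by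
      rw [vecMulLinear_apply, single_one_vecMul]; rfl⟩
    exact ⟨r, congrArg Subtype.val hr⟩
  choose l hl using hrow
  refine relMatrix_ne_vecMulVec ha hb habc hq l v (Matrix.ext fun i j => ?_)
  rw [← hl i]
  rfl

/-- The automorphism of the point scheme. -/
theorem exists_next_point {q : Fin 3 → k} (hq : q ≠ 0) (hdet : (relMatrix b a c q).det = 0) :
    ∃ p, p ≠ 0 ∧ (relMatrix b a c p).det = 0 ∧
      ∀ v ∈ orth p, ∃ α, q ᵥ* relMatrix a b c α = v := by
  obtain ⟨p, hp, hqp⟩ := exists_mulVec_eq_zero_iff.2 hdet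
  refine ⟨p, hp, ?_, fun v hv => ?_⟩
  · rw [← det_relMatrix_swap]
    exact exists_mulVec_eq_zero_iff.1 ⟨q, hq, by rw [← relMatrix_mulVec, hqp]⟩
  · have hle : LinearMap.range (relMatrix b a c q).vecMulLinear ≤ orth p := by
      rintro _ ⟨w, rfl⟩
      rw [mem_orth, vecMulLinear_apply, ← dotProduct_mulVec, hqp, dotProduct_zero]
    have heq := Submodule.eq_of_le_of_finrank_le hle (by
      rw [finrank_orth hp]
      exact two_le_finrank_range_vecMulLinear hb ha
        (fun h => habc ⟨h.1.symm, h.1.trans h.2⟩) hq)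
    obtain ⟨α, hα⟩ := heq ▸ hv
    exact ⟨α, by rw [vecMul_relMatrix]; exact hα⟩

theorem exists_relMatrix_eq_add {q l l' : Fin 3 → k} (hdet : (relMatrix b a c q).det = 0)
    (hll' : orth q = Submodule.span k {l, l'}) :
    ∃ α v v', v' ≠ 0 ∧ relMatrix a b c α = vecMulVec l v + vecMulVec l' v' := by
  obtain ⟨α, hα, hqα⟩ := exists_vecMul_eq_zero_iff.2 hdet
  rw [← vecMul_relMatrix] at hqα
  have hcol : ∀ j, ∃ s t : k, s • l + t • l' = (relMatrix a b c α).col j := fun j =>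
    Submodule.mem_span_pair.1 <| hll' ▸ mem_orth_comm.1 (congrFun hqα j)
  choose v v' hv using hcol
  have heq : relMatrix a b c α = vecMulVec l v + vecMulVec l' v' := by
    ext i j
    have := congrFun (hv j) i
    simp only [Pi.add_apply, Pi.smul_apply, smul_eq_mul, col_apply] at this
    rw [← this, Matrix.add_apply, vecMulVec_apply, vecMulVec_apply]
    ring
  refine ⟨α, v, v', ?_, heq⟩
  rintro rfl
  exact relMatrix_ne_vecMulVec ha hb habc hα l v (by simpa using heq)

end Nondegenerate

end LinearAlgebra

universe u

/-- `x` presents `S` as the Sklyanin algebra with parameters `a, b, c`. -/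
structure IsSklyanin {k S : Type u} [Field k] [Ring S] [Algebra k S] (a b c : k)
    (x : Fin 3 → S) : Prop where
  rel_zero : a • (x 1 * x 2) + b • (x 2 * x 1) + c • (x 0 * x 0) = 0
  rel_one : a • (x 2 * x 0) + b • (x 0 * x 2) + c • (x 1 * x 1) = 0
  rel_two : a • (x 0 * x 1) + b • (x 1 * x 0) + c • (x 2 * x 2) = 0
  exists_lift {B : Type u} [Ring B] [Algebra k B] (f : Fin 3 → B)
    (h₀ : a • (f 1 * f 2) + b • (f 2 * f 1) + c • (f 0 * f 0) = 0)
    (h₁ : a • (f 2 * f 0) + b • (f 0 * f 2) + c • (f 1 * f 1) = 0)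
    (h₂ : a • (f 0 * f 1) + b • (f 1 * f 0) + c • (f 2 * f 2) = 0) :
    ∃ φ : S →ₐ[k] B, ∀ i, φ (x i) = f i
  induction {P : S → Prop} (algebraMap : ∀ r, P (algebraMap k S r)) (gen : ∀ i, P (x i))
    (mul : ∀ s t, P s → P t → P (s * t)) (add : ∀ s t, P s → P t → P (s + t)) (s : S) : P s

theorem isSklyanin_ringQuot {k : Type u} [Field k] (a b c : k) :
    IsSklyanin a b c fun i =>
      RingQuot.mkAlgHom k (SklyaninRel k a b c) (FreeAlgebra.ι k i) where
  rel_zero := by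
    simpa only [map_add, map_smul, map_mul, map_zero] using
      RingQuot.mkAlgHom_rel k (SklyaninRel.r1 (k := k) (a := a) (b := b) (c := c))
  rel_one := by
    simpa only [map_add, map_smul, map_mul, map_zero] using
      RingQuot.mkAlgHom_rel k (SklyaninRel.r2 (k := k) (a := a) (b := b) (c := c))
  rel_two := by
    simpa only [map_add, map_smul, map_mul, map_zero] using
      RingQuot.mkAlgHom_rel k (SklyaninRel.r3 (k := k) (a := a) (b := b) (c := c))
  exists_lift f h₀ h₁ h₂ := by
    have hw : ∀ ⦃p q⦄, SklyaninRel k a b c p q →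
        FreeAlgebra.lift k f p = FreeAlgebra.lift k f q := by
      rintro p q (_ | _ | _) <;>
        simpa only [map_add, map_smul, map_mul, map_zero, FreeAlgebra.lift_ι_apply]
    exact ⟨RingQuot.liftAlgHom k ⟨FreeAlgebra.lift k f, hw⟩, fun i => by
      rw [RingQuot.liftAlgHom_mkAlgHom_apply, FreeAlgebra.lift_ι_apply]⟩
  induction hc hg hm ha s := by
    obtain ⟨w, rfl⟩ := RingQuot.mkAlgHom_surjective k (SklyaninRel k a b c) s
    induction w using FreeAlgebra.induction with
    | grade0 r =>
      rw [AlgHom.commutes]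
      exact hc r
    | grade1 i => exact hg i
    | mul p q hp hq =>
      rw [map_mul]
      exact hm _ _ hp hq
    | add p q hp hq =>
      rw [map_add]
      exact ha _ _ hp hq

namespace IsSklyanin

section Presentation

variable {k S : Type u} [Field k] [Ring S] [Algebra k S] {a b c : k} {x : Fin 3 → S}

/-- The augmentation, killing the generators. -/
theorem exists_augmentation (hS : IsSklyanin a b c x) : ∃ ε : S →ₐ[k] k, ∀ i, ε (x i) = 0 :=
  hS.exists_lift (fun _ => 0) (by simp) (by simp) (by simp)

/-- The module of relations `Σ xⱼ ⊗ sⱼ` is generated on the right by the defining relations. -/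
theorem syzygy (hS : IsSklyanin a b c x) {s₀ s₁ s₂ : S}
    (h : x 0 * s₀ + x 1 * s₁ + x 2 * s₂ = 0) :
    ∃ u₀ u₁ u₂ : S,
      s₀ = c • (x 0 * u₀) + b • (x 2 * u₁) + a • (x 1 * u₂) ∧
      s₁ = a • (x 2 * u₀) + c • (x 1 * u₁) + b • (x 0 * u₂) ∧
      s₂ = b • (x 1 * u₀) + a • (x 0 * u₁) + c • (x 2 * u₂) := by
  let L := fun i => LinearMap.mulLeft k (x i)
  let p₀ : S × S × S →ₗ[k] S := LinearMap.fst k _ _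
  let p₁ : S × S × S →ₗ[k] S := LinearMap.fst k _ _ ∘ₗ LinearMap.snd k _ _
  let p₂ : S × S × S →ₗ[k] S := LinearMap.snd k _ _ ∘ₗ LinearMap.snd k _ _
  let N : S × S × S →ₗ[k] S × S × S :=
    (c • L 0 ∘ₗ p₀ + b • L 2 ∘ₗ p₁ + a • L 1 ∘ₗ p₂).prod
      ((a • L 2 ∘ₗ p₀ + c • L 1 ∘ₗ p₁ + b • L 0 ∘ₗ p₂).prod
        (b • L 1 ∘ₗ p₀ + a • L 0 ∘ₗ p₁ + c • L 2 ∘ₗ p₂))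
  let e : Fin 3 → S →ₗ[k] S × S × S :=
    ![LinearMap.inl k _ _, LinearMap.inr k _ _ ∘ₗ LinearMap.inl k _ _,
      LinearMap.inr k _ _ ∘ₗ LinearMap.inr k _ _]
  let π := (LinearMap.range N).mkQ
  let T : Fin 3 → Module.End k (S × ((S × S × S) ⧸ LinearMap.range N)) := fun i =>
    (L i ∘ₗ LinearMap.fst k _ _).prod (π ∘ₗ e i ∘ₗ LinearMap.fst k _ _)
  have hT : ∀ i s q, T i (s, q) = (x i * s, π (e i s)) := fun i s q => rfl
  have hπ : ∀ u, π (N u) = 0 := fun u => by simp [π]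
  obtain ⟨ρ, hρ⟩ := hS.exists_lift T
    (by
      refine LinearMap.ext fun ⟨s, q⟩ => Prod.ext ?_ ?_
      · simpa [hT, mul_assoc, add_mul, smul_mul_assoc] using congrArg (· * s)
          hS.rel_zero
      · simpa [hT, N, p₀, p₁, p₂, L, e, ← map_smul, ← map_add] using hπ (s, 0, 0))
    (by
      refine LinearMap.ext fun ⟨s, q⟩ => Prod.ext ?_ ?_
      · simpa [hT, mul_assoc, add_mul, smul_mul_assoc] using congrArg (· * s)
          hS.rel_one
      · simpa [hT, N, p₀, p₁, p₂, L, e, ← map_smul, ← map_add] using hπ (0, s, 0))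
    (by
      refine LinearMap.ext fun ⟨s, q⟩ => Prod.ext ?_ ?_
      · simpa [hT, mul_assoc, add_mul, smul_mul_assoc] using congrArg (· * s)
          hS.rel_two
      · simpa [hT, N, p₀, p₁, p₂, L, e, ← map_smul, ← map_add] using hπ (0, 0, s))
  have hfst : ∀ s v, (ρ s v).1 = s * v.1 := by
    intro s
    induction s using hS.induction with
    | algebraMap r => intro v; simp [Algebra.smul_def]
    | gen i => intro v; rw [hρ]; rfl
    | mul s t hs ht => intro v; rw [map_mul, Module.End.mul_apply, hs, ht, mul_assoc]
    | add s t hs ht => intro v; rw [map_add, LinearMap.add_apply, Prod.fst_add, hs, ht, add_mul]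
  have hsnd : ∀ i s, (ρ (x i * s) (1, 0)).2 = π (e i s) := by
    intro i s
    rw [map_mul, Module.End.mul_apply, hρ, ← Prod.mk.eta (p := ρ s (1, 0)), hT, hfst, mul_one]
  have key : π (s₀, s₁, s₂) = 0 := by
    have h' := congrArg (fun t => (ρ t (1, 0)).2) h
    simp only [map_add, LinearMap.add_apply, Prod.snd_add] at h'
    rw [hsnd, hsnd, hsnd] at h'
    simpa [e, ← map_add] using h'
  obtain ⟨⟨u₀, u₁, u₂⟩, hu⟩ := (Submodule.Quotient.mk_eq_zero _).1 key
  refine ⟨u₀, u₁, u₂, ?_, ?_, ?_⟩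
  · exact (congrArg Prod.fst hu).symm
  · exact (congrArg (fun t => t.2.1) hu).symm
  · exact (congrArg (fun t => t.2.2) hu).symm

/-- Projections of the Sklyanin algebra onto its homogeneous components. -/
theorem exists_projection (hS : IsSklyanin a b c x) : ∃ p : ℕ → S →ₗ[k] S,
    (∀ m s, p m s ∈ Submodule.span k (Set.range (x)) ^ m) ∧
    (∀ m, ∀ s ∈ Submodule.span k (Set.range (x)) ^ m, p m s = s) ∧
    ∀ m i s, p (m + 1) (x i * s) = x i * p m s := by
  obtain ⟨φ, hφ⟩ := hS.exists_lift (fun i => Polynomial.monomial 1 (x i))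
    (by simp only [Polynomial.monomial_mul_monomial, Polynomial.smul_monomial, ← map_add,
      hS.rel_zero, map_zero])
    (by simp only [Polynomial.monomial_mul_monomial, Polynomial.smul_monomial, ← map_add,
      hS.rel_one, map_zero])
    (by simp only [Polynomial.monomial_mul_monomial, Polynomial.smul_monomial, ← map_add,
      hS.rel_two, map_zero])
  have hx : ∀ i, x i ∈ Submodule.span k (Set.range x) := fun i =>
    Submodule.subset_span ⟨i, rfl⟩
  have hc : ∀ s m, (φ s).coeff m ∈ Submodule.span k (Set.range x) ^ m := by
    intro s
    induction s using hS.induction with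
    | algebraMap r =>
      intro m
      rw [AlgHom.commutes, Polynomial.algebraMap_apply, Polynomial.coeff_C]
      split_ifs with hm
      · subst hm
        rw [pow_zero]
        exact Submodule.algebraMap_mem r
      · exact zero_mem _
    | gen i =>
      intro m
      rw [hφ, Polynomial.coeff_monomial]
      split_ifs with hm
      · subst hm
        rw [pow_one]
        exact hx i
      · exact zero_mem _
    | mul s t hs ht =>
      intro m
      rw [map_mul, Polynomial.coeff_mul]
      refine Submodule.sum_mem _ fun ij hij => ?_
      rw [← Finset.HasAntidiagonal.mem_antidiagonal.1 hij, pow_add]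
      exact Submodule.mul_mem_mul (hs _) (ht _)
    | add s t hs ht =>
      intro m
      rw [map_add, Polynomial.coeff_add]
      exact add_mem (hs m) (ht m)
  have hmono : ∀ m, ∀ s ∈ Submodule.span k (Set.range x) ^ m, φ s = Polynomial.monomial m s := by
    intro m
    induction m with
    | zero =>
      intro s hs
      rw [pow_zero, Submodule.mem_one] at hs
      obtain ⟨r, rfl⟩ := hs
      rw [AlgHom.commutes, Polynomial.algebraMap_apply, Polynomial.monomial_zero_left]
    | succ m ih =>
      intro s hs
      rw [pow_succ'] at hs
      induction hs using Submodule.mul_induction_on' with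
      | mem_mul_mem v hv t ht =>
        rw [map_mul, ih t ht]
        have hv' : φ v = Polynomial.monomial 1 v := by
          induction hv using Submodule.span_induction with
          | mem v hv => obtain ⟨i, rfl⟩ := hv; exact hφ i
          | zero => simp
          | add v w _ _ hv hw => rw [map_add, hv, hw, map_add]
          | smul r v _ hv => rw [map_smul, hv, Polynomial.smul_monomial]
        rw [hv', Polynomial.monomial_mul_monomial, add_comm]
      | add s hs t ht hs' ht' => rw [map_add, hs', ht', map_add]
  refine ⟨fun m => (Polynomial.lcoeff _ m).restrictScalars k ∘ₗ φ.toLinearMap,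
    fun m s => hc s m, fun m s hs => ?_, fun m i s => ?_⟩
  · simp [hmono m s hs]
  · simp [hφ]
    exact Polynomial.coeff_monomial_mul _ 1 m _

end Presentation

end IsSklyanin

namespace IsSklyanin

open Matrix Module

variable {k S : Type u} [Field k] [Ring S] [Algebra k S] {a b c : k} {x : Fin 3 → S}

local notation "𝒱" => Submodule.span k (Set.range x)

local notation "ℓ" => Fintype.linearCombination k x

theorem linearCombination_mem (v : Fin 3 → k) : ℓ v ∈ 𝒱 := by
  rw [← Fintype.range_linearCombination]
  exact ⟨v, rfl⟩

theorem gen_mem (i : Fin 3) : x i ∈ 𝒱 := Submodule.subset_span ⟨i, rfl⟩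

theorem mul_mem_pow_succ {s t : S} {m : ℕ} (hs : s ∈ 𝒱) (ht : t ∈ 𝒱 ^ m) :
    s * t ∈ 𝒱 ^ (m + 1) := by
  rw [pow_succ']
  exact Submodule.mul_mem_mul hs ht

instance finiteDimensional_span_range_pow (m : ℕ) : FiniteDimensional k ↥(𝒱 ^ m) :=
  Module.Finite.iff_fg.2 ((Submodule.fg_span (Set.finite_range x)).pow m)

/-- A quadratic relation, from its matrix of coefficients. -/
theorem sum_relMatrix (hS : IsSklyanin a b c x) (α : Fin 3 → k) :
    ∑ i, x i * ℓ (relMatrix a b c α i) = 0 := by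
  have h := congrArg₂ (· + ·) (congrArg₂ (· + ·) (congrArg (α 0 • ·) hS.rel_zero)
    (congrArg (α 1 • ·) hS.rel_one)) (congrArg (α 2 • ·) hS.rel_two)
  simp only [smul_zero, add_zero] at h
  rw [← h]
  simp [relMatrix, Fintype.linearCombination_apply, Fin.sum_univ_three, mul_add, smul_smul]
  module

theorem mul_add_mul_eq_zero (hS : IsSklyanin a b c x) {α l v l' v' : Fin 3 → k}
    (h : relMatrix a b c α = vecMulVec l v + vecMulVec l' v') :
    ℓ l * ℓ v + ℓ l' * ℓ v' = 0 := by
  have hrow : ∀ i, relMatrix a b c α i = l i • v + l' i • v' := fun i => by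
    rw [h]
    rfl
  rw [← hS.sum_relMatrix α]
  simp only [hrow, map_add, map_smul, mul_add, mul_smul_comm, Finset.sum_add_distrib]
  rw [Fintype.linearCombination_apply k x l, Fintype.linearCombination_apply k x l',
    Finset.sum_mul, Finset.sum_mul]
  simp only [smul_mul_assoc]

theorem linearCombination_mul_vecMul_mem (hS : IsSklyanin a b c x) {q τ : Fin 3 → k}
    (hτ : τ ⬝ᵥ q = 1) (α : Fin 3 → k) :
    ℓ τ * ℓ (q ᵥ* relMatrix a b c α) ∈ (orth q).map ℓ * 𝒱 := by
  have hsum : ℓ τ * ℓ (q ᵥ* relMatrix a b c α) =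
      -∑ i, ℓ (Pi.single i 1 - q i • τ) * ℓ (relMatrix a b c α i) := by
    have hv : q ᵥ* relMatrix a b c α = ∑ i, q i • relMatrix a b c α i := by
      rw [vecMul_eq_sum]
    have h := hS.sum_relMatrix α
    simp only [hv, map_sub, map_sum, map_smul, sub_mul, Finset.sum_sub_distrib, smul_mul_assoc,
      Finset.mul_sum, mul_smul_comm, Fintype.linearCombination_apply_single, one_smul, h]
    simp
  rw [hsum]
  refine neg_mem (sum_mem fun i _ => Submodule.mul_mem_mul ⟨_, ?_, rfl⟩ (linearCombination_mem _))
  rw [SetLike.mem_coe, mem_orth, sub_dotProduct, smul_dotProduct, hτ, single_dotProduct]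
  simp

theorem exists_dotProduct_eq_one {q : Fin 3 → k} (hq : q ≠ 0) : ∃ τ : Fin 3 → k, τ ⬝ᵥ q = 1 := by
  obtain ⟨i, hi⟩ := Function.ne_iff.1 hq
  exact ⟨Pi.single i (q i)⁻¹, by rw [single_dotProduct, inv_mul_cancel₀ hi]⟩

theorem span_range_le_sup {q τ : Fin 3 → k} (hτ : τ ⬝ᵥ q = 1) :
    𝒱 ≤ Submodule.span k {ℓ τ} ⊔ (orth q).map ℓ := by
  rw [← Fintype.range_linearCombination]
  rintro _ ⟨v, rfl⟩
  refine Submodule.mem_sup.2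
    ⟨_, Submodule.smul_mem _ (v ⬝ᵥ q) (Submodule.mem_span_singleton_self _), _, ⟨v - (v ⬝ᵥ q) • τ, ?_, rfl⟩, ?_⟩
  · rw [SetLike.mem_coe, mem_orth, sub_dotProduct, smul_dotProduct, hτ]
    simp
  · simp

section Nondegenerate

variable (hS : IsSklyanin a b c x) (ha : a ≠ 0) (hb : b ≠ 0)
  (habc : ¬(a ^ 3 = b ^ 3 ∧ b ^ 3 = c ^ 3))

include hS ha hb habc

/-- The point modules have at most one dimension in each degree. -/
theorem exists_pow_succ_le_sup (m : ℕ) : ∀ q : Fin 3 → k, q ≠ 0 → (relMatrix b a c q).det = 0 →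
    ∃ s, 𝒱 ^ (m + 1) ≤ Submodule.span k {s} ⊔ (orth q).map ℓ * 𝒱 ^ m := by
  induction m with
  | zero =>
    intro q hq _
    obtain ⟨τ, hτ⟩ := exists_dotProduct_eq_one hq
    refine ⟨ℓ τ, ?_⟩
    rw [zero_add, pow_one, pow_zero, mul_one]
    exact span_range_le_sup hτ
  | succ m ih =>
    intro q hq hdet
    obtain ⟨τ, hτ⟩ := exists_dotProduct_eq_one hq
    obtain ⟨p, hp, hpdet, hpq⟩ := exists_next_point ha hb habc hq hdet
    obtain ⟨s, hs⟩ := ih p hp hpdet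
    refine ⟨ℓ τ * s, ?_⟩
    have hnext : Submodule.span k {ℓ τ} * (orth p).map ℓ ≤ (orth q).map ℓ * 𝒱 := by
      refine Submodule.mul_le.2 ?_
      rintro t ht _ ⟨v, hv, rfl⟩
      obtain ⟨r, rfl⟩ := Submodule.mem_span_singleton.1 ht
      obtain ⟨α, rfl⟩ := hpq v hv
      rw [smul_mul_assoc]
      exact Submodule.smul_mem _ _ (hS.linearCombination_mul_vecMul_mem hτ α)
    calc 𝒱 ^ (m + 1 + 1)
        ≤ (Submodule.span k {ℓ τ} ⊔ (orth q).map ℓ) * 𝒱 ^ (m + 1) := by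
          rw [pow_succ' _ (m + 1)]
          exact mul_le_mul_left (span_range_le_sup hτ) _
      _ ≤ Submodule.span k {ℓ τ} * (Submodule.span k {s} ⊔ (orth p).map ℓ * 𝒱 ^ m) ⊔
            (orth q).map ℓ * 𝒱 ^ (m + 1) := by
          rw [Submodule.sup_mul]
          exact sup_le_sup_right (mul_le_mul_right hs _) _
      _ ≤ Submodule.span k {ℓ τ * s} ⊔ (orth q).map ℓ * 𝒱 ^ (m + 1) := by
          rw [Submodule.mul_sup, Submodule.span_mul_span, Set.singleton_mul_singleton, ← mul_assoc,
            sup_assoc]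
          refine sup_le_sup_left (sup_le ?_ le_rfl) _
          rw [pow_succ' _ m, ← mul_assoc]
          exact mul_le_mul_left hnext _

end Nondegenerate

theorem linearCombination_injective (hS : IsSklyanin a b c x) : Function.Injective ℓ := by
  refine (injective_iff_map_eq_zero _).2 fun v hv => ?_
  rw [Fintype.linearCombination_apply, Fin.sum_univ_three] at hv
  obtain ⟨ε, hε⟩ := hS.exists_augmentation
  obtain ⟨u₀, u₁, u₂, h₀, h₁, h₂⟩ := hS.syzygy (s₀ := algebraMap k S (v 0))
    (s₁ := algebraMap k S (v 1)) (s₂ := algebraMap k S (v 2))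
    (by simpa only [Algebra.smul_def, Algebra.commutes] using hv)
  ext i
  fin_cases i
  · simpa [hε] using congrArg ε h₀
  · simpa [hε] using congrArg ε h₁
  · simpa [hε] using congrArg ε h₂

theorem finrank_pow_zero (hS : IsSklyanin a b c x) : finrank k ↥(𝒱 ^ 0) = 1 := by
  obtain ⟨ε, -⟩ := hS.exists_augmentation
  have : Nontrivial S := ε.toRingHom.domain_nontrivial
  rw [pow_zero, Submodule.one_eq_span, finrank_span_singleton one_ne_zero]

theorem finrank_pow_one (hS : IsSklyanin a b c x) : finrank k ↥(𝒱 ^ 1) = 3 := by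
  rw [pow_one, ← Fintype.range_linearCombination,
    LinearMap.finrank_range_of_inj hS.linearCombination_injective, Module.finrank_fin_fun]

theorem eq_zero_of_mul_eq_zero_of_mem_pow_zero (hS : IsSklyanin a b c x) {l : Fin 3 → k}
    (hl : l ≠ 0) {w : S} (hw : w ∈ 𝒱 ^ 0) (h : ℓ l * w = 0) : w = 0 := by
  rw [pow_zero, Submodule.mem_one] at hw
  obtain ⟨r, rfl⟩ := hw
  rw [← Algebra.commutes, ← Algebra.smul_def, ← map_smul] at h
  have := hS.linearCombination_injective (h.trans (map_zero _).symm)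
  rw [(smul_eq_zero.1 this).resolve_right hl, map_zero]

theorem syzygy_pow (hS : IsSklyanin a b c x) {m : ℕ} {s₀ s₁ s₂ : S} (h₀ : s₀ ∈ 𝒱 ^ (m + 1))
    (h₁ : s₁ ∈ 𝒱 ^ (m + 1)) (h₂ : s₂ ∈ 𝒱 ^ (m + 1))
    (h : x 0 * s₀ + x 1 * s₁ + x 2 * s₂ = 0) :
    ∃ u₀ ∈ 𝒱 ^ m, ∃ u₁ ∈ 𝒱 ^ m, ∃ u₂ ∈ 𝒱 ^ m,
      s₀ = c • (x 0 * u₀) + b • (x 2 * u₁) + a • (x 1 * u₂) ∧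
      s₁ = a • (x 2 * u₀) + c • (x 1 * u₁) + b • (x 0 * u₂) ∧
      s₂ = b • (x 1 * u₀) + a • (x 0 * u₁) + c • (x 2 * u₂) := by
  obtain ⟨u₀, u₁, u₂, e₀, e₁, e₂⟩ := hS.syzygy h
  obtain ⟨p, hmem, hid, hmul⟩ := hS.exists_projection
  refine ⟨p m u₀, hmem _ _, p m u₁, hmem _ _, p m u₂, hmem _ _, ?_, ?_, ?_⟩
  · rw [← hid _ _ h₀]
    simp only [e₀, map_add, map_smul, hmul]
  · rw [← hid _ _ h₁]
    simp only [e₁, map_add, map_smul, hmul]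
  · rw [← hid _ _ h₂]
    simp only [e₂, map_add, map_smul, hmul]

/-- The triples of the form `(x₀w, x₁w, x₂w)`. -/
def diagMap (x : Fin 3 → S) : S →ₗ[k] S × S × S :=
  (LinearMap.mulLeft k (x 0)).prod ((LinearMap.mulLeft k (x 1)).prod (LinearMap.mulLeft k (x 2)))

/-- The matrix of first syzygies of `x`, acting on columns. -/
def syzygyMap (a b c : k) (x : Fin 3 → S) : S × S × S →ₗ[k] S × S × S :=
  ((c • LinearMap.mulLeft k (x 0)).coprod
    ((b • LinearMap.mulLeft k (x 2)).coprod (a • LinearMap.mulLeft k (x 1)))).prod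
  (((a • LinearMap.mulLeft k (x 2)).coprod
    ((c • LinearMap.mulLeft k (x 1)).coprod (b • LinearMap.mulLeft k (x 0)))).prod
  ((b • LinearMap.mulLeft k (x 1)).coprod
    ((a • LinearMap.mulLeft k (x 0)).coprod (c • LinearMap.mulLeft k (x 2)))))

theorem syzygyMap_apply (u₀ u₁ u₂ : S) : syzygyMap a b c x (u₀, u₁, u₂) =
    (c • (x 0 * u₀) + (b • (x 2 * u₁) + a • (x 1 * u₂)),
      a • (x 2 * u₀) + (c • (x 1 * u₁) + b • (x 0 * u₂)),
      b • (x 1 * u₀) + (a • (x 0 * u₁) + c • (x 2 * u₂))) := rfl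

theorem finrank_pow_add_two_ge (hS : IsSklyanin a b c x) (m : ℕ) :
    3 * finrank k ↥(𝒱 ^ (m + 1)) + finrank k ↥((𝒱 ^ m).prod ((𝒱 ^ m).prod (𝒱 ^ m)) ⊓
      LinearMap.ker (syzygyMap a b c x)) ≤
    finrank k ↥(𝒱 ^ (m + 2)) + 3 * finrank k ↥(𝒱 ^ m) := by
  set φ : S × S × S →ₗ[k] S := (LinearMap.mulLeft k (x 0)).coprod
    ((LinearMap.mulLeft k (x 1)).coprod (LinearMap.mulLeft k (x 2))) with hφ
  have hφ_apply : ∀ s, φ s = x 0 * s.1 + (x 1 * s.2.1 + x 2 * s.2.2) := fun s => by simp [hφ]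
  have himg : ((𝒱 ^ (m + 1)).prod ((𝒱 ^ (m + 1)).prod (𝒱 ^ (m + 1)))).map φ ≤ 𝒱 ^ (m + 2) := by
    rintro _ ⟨s, ⟨h₀, h₁, h₂⟩, rfl⟩
    rw [hφ_apply]
    exact add_mem (mul_mem_pow_succ (gen_mem 0) h₀)
      (add_mem (mul_mem_pow_succ (gen_mem 1) h₁) (mul_mem_pow_succ (gen_mem 2) h₂))
  have hker : (𝒱 ^ (m + 1)).prod ((𝒱 ^ (m + 1)).prod (𝒱 ^ (m + 1))) ⊓ LinearMap.ker φ ≤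
      ((𝒱 ^ m).prod ((𝒱 ^ m).prod (𝒱 ^ m))).map (syzygyMap a b c x) := by
    rintro ⟨s₀, s₁, s₂⟩ ⟨⟨h₀, h₁, h₂⟩, hs⟩
    rw [SetLike.mem_coe, LinearMap.mem_ker, hφ_apply, ← add_assoc] at hs
    obtain ⟨u₀, hu₀, u₁, hu₁, u₂, hu₂, e₀, e₁, e₂⟩ :=
      hS.syzygy_pow (s₀ := s₀) (s₁ := s₁) (s₂ := s₂) h₀ h₁ h₂ hs
    refine ⟨(u₀, u₁, u₂), ⟨hu₀, hu₁, hu₂⟩, ?_⟩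
    rw [syzygyMap_apply, e₀, e₁, e₂]
    simp only [add_assoc]
  have hφrank := Submodule.finrank_map_add_finrank_inf_ker φ
    ((𝒱 ^ (m + 1)).prod ((𝒱 ^ (m + 1)).prod (𝒱 ^ (m + 1))))
  have hψrank := Submodule.finrank_map_add_finrank_inf_ker (syzygyMap a b c x)
    ((𝒱 ^ m).prod ((𝒱 ^ m).prod (𝒱 ^ m)))
  simp only [Submodule.finrank_prod] at hφrank hψrank
  have := Submodule.finrank_mono himg
  have := Submodule.finrank_mono hker
  omega

theorem finrank_pow_add_three_ge (hS : IsSklyanin a b c x) (m : ℕ)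
    (hreg : ∀ w ∈ 𝒱 ^ m, x 0 * w = 0 → w = 0) :
    3 * finrank k ↥(𝒱 ^ (m + 2)) + finrank k ↥(𝒱 ^ m) ≤
      finrank k ↥(𝒱 ^ (m + 3)) + 3 * finrank k ↥(𝒱 ^ (m + 1)) := by
  refine le_trans (Nat.add_le_add_left ?_ _) (hS.finrank_pow_add_two_ge (m + 1))
  rw [← Submodule.finrank_map_of_forall (f := diagMap (k := k) x) fun w hw h =>
    hreg w hw (congrArg Prod.fst h)]
  refine Submodule.finrank_mono ?_
  rintro _ ⟨w, hw, rfl⟩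
  refine ⟨⟨mul_mem_pow_succ (gen_mem 0) hw, mul_mem_pow_succ (gen_mem 1) hw,
    mul_mem_pow_succ (gen_mem 2) hw⟩, ?_⟩
  have h₀ := congrArg (· * w) hS.rel_zero
  have h₁ := congrArg (· * w) hS.rel_one
  have h₂ := congrArg (· * w) hS.rel_two
  simp only [add_mul, smul_mul_assoc, zero_mul, mul_assoc] at h₀ h₁ h₂
  refine (syzygyMap_apply (x 0 * w) (x 1 * w) (x 2 * w)).trans ?_
  rw [Prod.mk_eq_zero, Prod.mk_eq_zero]
  refine ⟨?_, ?_, ?_⟩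
  · rw [← h₀]; abel
  · rw [← h₁]; abel
  · rw [← h₂]; abel

theorem map_le_inf_ker {l l' v v' : Fin 3 → k} (h : ℓ l * ℓ v + ℓ l' * ℓ v' = 0) (n : ℕ) :
    (𝒱 ^ n).map ((LinearMap.mulLeft k (ℓ v)).prod (LinearMap.mulLeft k (ℓ v'))) ≤
      (𝒱 ^ (n + 1)).prod (𝒱 ^ (n + 1)) ⊓
        LinearMap.ker ((LinearMap.mulLeft k (ℓ l)).coprod (LinearMap.mulLeft k (ℓ l'))) := by
  rintro _ ⟨w, hw, rfl⟩
  refine ⟨⟨mul_mem_pow_succ (linearCombination_mem v) hw,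
    mul_mem_pow_succ (linearCombination_mem v') hw⟩, ?_⟩
  have := congrArg (· * w) h
  simpa [add_mul, mul_assoc] using this

variable (hS : IsSklyanin a b c x) (ha : a ≠ 0) (hb : b ≠ 0)
  (habc : ¬(a ^ 3 = b ^ 3 ∧ b ^ 3 = c ^ 3))

include hS ha hb habc

/-- The kernel of `(s, s') ↦ l s + l' s'` in a given degree, when `l, l'` cut out a point of the
point scheme. -/
theorem finrank_inf_ker_add_finrank_pow_succ_le {q l l' : Fin 3 → k} (hq : q ≠ 0)
    (hdet : (relMatrix b a c q).det = 0) (hll' : orth q = Submodule.span k {l, l'}) (m : ℕ) :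
    finrank k ↥((𝒱 ^ m).prod (𝒱 ^ m) ⊓
      LinearMap.ker ((LinearMap.mulLeft k (ℓ l)).coprod (LinearMap.mulLeft k (ℓ l')))) +
        finrank k ↥(𝒱 ^ (m + 1)) ≤ 2 * finrank k ↥(𝒱 ^ m) + 1 := by
  set φ : S × S →ₗ[k] S := (LinearMap.mulLeft k (ℓ l)).coprod (LinearMap.mulLeft k (ℓ l'))
    with hφ
  have himg : (orth q).map ℓ * 𝒱 ^ m ≤ ((𝒱 ^ m).prod (𝒱 ^ m)).map φ := by
    refine Submodule.mul_le.2 ?_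
    rintro _ ⟨v, hv, rfl⟩ s hs
    obtain ⟨r, r', rfl⟩ := Submodule.mem_span_pair.1 (hll' ▸ hv)
    refine ⟨(r • s, r' • s), ⟨Submodule.smul_mem _ r hs, Submodule.smul_mem _ r' hs⟩, ?_⟩
    simp [hφ, add_mul]
  obtain ⟨s, hs⟩ := hS.exists_pow_succ_le_sup ha hb habc m q hq hdet
  have hle := Submodule.finrank_mono (hs.trans (sup_le_sup_left himg _))
  have hsup := Submodule.finrank_add_le_finrank_add_finrank (Submodule.span k {s})
    (((𝒱 ^ m).prod (𝒱 ^ m)).map φ)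
  have hone := finrank_span_le_card (R := k) ({s} : Set S)
  have hrank := Submodule.finrank_map_add_finrank_inf_ker φ ((𝒱 ^ m).prod (𝒱 ^ m))
  rw [Submodule.finrank_prod] at hrank
  simp only [Set.toFinset_singleton, Finset.card_singleton] at hone
  omega

variable [IsAlgClosed k]

theorem exists_mul_add_mul_eq_zero {l : Fin 3 → k} (hl : l ≠ 0) :
    ∃ l' v v' : Fin 3 → k, v' ≠ 0 ∧ ℓ l * ℓ v + ℓ l' * ℓ v' = 0 ∧
      ∀ m, finrank k ↥((𝒱 ^ m).prod (𝒱 ^ m) ⊓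
        LinearMap.ker ((LinearMap.mulLeft k (ℓ l)).coprod (LinearMap.mulLeft k (ℓ l')))) +
          finrank k ↥(𝒱 ^ (m + 1)) ≤ 2 * finrank k ↥(𝒱 ^ m) + 1 := by
  obtain ⟨q, hq, hlq, hdet⟩ := exists_det_relMatrix_eq_zero (a := a) (b := b) (c := c) hl
  obtain ⟨l', hll'⟩ := exists_span_pair_eq_orth hl hq hlq
  obtain ⟨α, v, v', hv', hα⟩ := exists_relMatrix_eq_add ha hb habc hdet hll'
  exact ⟨l', v, v', hv', hS.mul_add_mul_eq_zero hα, fun m =>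
    hS.finrank_inf_ker_add_finrank_pow_succ_le ha hb habc hq hdet hll' m⟩

theorem finrank_pow_add_two_le {n : ℕ}
    (hreg : ∀ l : Fin 3 → k, l ≠ 0 → ∀ w ∈ 𝒱 ^ n, ℓ l * w = 0 → w = 0) :
    finrank k ↥(𝒱 ^ n) + finrank k ↥(𝒱 ^ (n + 2)) ≤ 2 * finrank k ↥(𝒱 ^ (n + 1)) + 1 := by
  obtain ⟨l', v, v', hv', h, hle⟩ :=
    hS.exists_mul_add_mul_eq_zero ha hb habc (one_ne_zero (α := Fin 3 → k))
  refine le_trans (Nat.add_le_add_right ?_ _) (hle (n + 1))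
  rw [← Submodule.finrank_map_of_forall
    (f := (LinearMap.mulLeft k (ℓ v)).prod (LinearMap.mulLeft k (ℓ v')))
    fun w hw hw0 => hreg v' hv' w hw (congrArg Prod.snd hw0)]
  exact Submodule.finrank_mono (map_le_inf_ker h n)

theorem eq_zero_of_mul_eq_zero_succ {n : ℕ}
    (hreg : ∀ l : Fin 3 → k, l ≠ 0 → ∀ w ∈ 𝒱 ^ n, ℓ l * w = 0 → w = 0)
    (hrank : 2 * finrank k ↥(𝒱 ^ (n + 1)) + 1 ≤ finrank k ↥(𝒱 ^ n) + finrank k ↥(𝒱 ^ (n + 2)))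
    {l : Fin 3 → k} (hl : l ≠ 0) {u : S} (hu : u ∈ 𝒱 ^ (n + 1)) (hlu : ℓ l * u = 0) : u = 0 := by
  obtain ⟨l', v, v', hv', h, hle⟩ := hS.exists_mul_add_mul_eq_zero ha hb habc hl
  have heq := Submodule.eq_of_le_of_finrank_le (map_le_inf_ker h n) (by
    rw [Submodule.finrank_map_of_forall fun w hw hw0 => hreg v' hv' w hw (congrArg Prod.snd hw0)]
    have : _ + finrank k ↥(𝒱 ^ (n + 2)) ≤ _ := hle (n + 1)
    omega)
  obtain ⟨w, hw, hwu⟩ : (u, (0 : S)) ∈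
      (𝒱 ^ n).map ((LinearMap.mulLeft k (ℓ v)).prod (LinearMap.mulLeft k (ℓ v'))) := by
    rw [heq]
    exact ⟨⟨hu, zero_mem _⟩, by simpa using hlu⟩
  have hw0 : w = 0 := hreg v' hv' w hw (congrArg Prod.snd hwu)
  have hu0 : ℓ v * w = u := congrArg Prod.fst hwu
  rw [← hu0, hw0, mul_zero]

theorem regular_and_finrank_pow (n : ℕ) :
    (∀ l : Fin 3 → k, l ≠ 0 → ∀ w ∈ 𝒱 ^ n, ℓ l * w = 0 → w = 0) ∧
      2 * finrank k ↥(𝒱 ^ n) = (n + 1) * (n + 2) ∧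
      2 * finrank k ↥(𝒱 ^ (n + 1)) = (n + 2) * (n + 3) ∧
      2 * finrank k ↥(𝒱 ^ (n + 2)) = (n + 3) * (n + 4) := by
  induction n with
  | zero =>
    have hreg : ∀ l : Fin 3 → k, l ≠ 0 → ∀ w ∈ 𝒱 ^ 0, ℓ l * w = 0 → w = 0 :=
      fun l hl w hw => hS.eq_zero_of_mul_eq_zero_of_mem_pow_zero hl hw
    have h₀ := hS.finrank_pow_zero
    have h₁ : finrank k ↥(𝒱 ^ (0 + 1)) = 3 := hS.finrank_pow_one
    have hle := hS.finrank_pow_add_two_le ha hb habc hreg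
    have hge := hS.finrank_pow_add_two_ge 0
    exact ⟨hreg, by omega, by omega, by omega⟩
  | succ n ih =>
    obtain ⟨hreg, h₀, h₁, h₂⟩ := ih
    have hreg' : ∀ l : Fin 3 → k, l ≠ 0 → ∀ w ∈ 𝒱 ^ (n + 1), ℓ l * w = 0 → w = 0 :=
      fun l hl w hw => hS.eq_zero_of_mul_eq_zero_succ ha hb habc hreg (by lia) hl hw
    have hle := hS.finrank_pow_add_two_le ha hb habc hreg'
    have hge := hS.finrank_pow_add_three_ge n fun w hw h =>
      hreg (Pi.single 0 1) (by simp) w hw (by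
        rwa [Fintype.linearCombination_apply_single, one_smul])
    exact ⟨hreg', by lia, by lia, by lia⟩

theorem finrank_pow (m : ℕ) : finrank k ↥(𝒱 ^ m) = (m + 1) * (m + 2) / 2 := by
  have := (hS.regular_and_finrank_pow ha hb habc m).2.1
  omega

end IsSklyanin

theorem span_prod_ofFn_eq_pow {k S ι : Type*} [CommSemiring k] [Semiring S] [Algebra k S]
    (x : ι → S) (m : ℕ) :
    Submodule.span k {s : S | ∃ w : Fin m → ι, s = (List.ofFn fun j => x (w j)).prod} =
      Submodule.span k (Set.range x) ^ m := by
  rw [Submodule.span_pow]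
  congr 1
  ext s
  rw [Set.mem_pow]
  constructor
  · rintro ⟨w, rfl⟩
    exact ⟨fun j => ⟨x (w j), w j, rfl⟩, rfl⟩
  · rintro ⟨f, rfl⟩
    choose w hw using fun j => (f j).2
    exact ⟨w, by simp only [hw]⟩

/-- The 3-dimensional Sklyanin algebra `S(a,b,c)` has the Hilbert series `(1−t)⁻³` of a
polynomial ring in three variables: the degree-`m` component (the image in `S` of the span
of all words of length `m` in `x, y, z`) has `k`-dimension `(m+1)(m+2)/2`. -/
theorem sklyanin_hilbert_series
    (k : Type*) [Field k] [IsAlgClosed k] [CharZero k]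
    (a b c : k) (habc : a * b * c ≠ 0)
    (hdeg : (3 * a * b * c) ^ 3 ≠ (a ^ 3 + b ^ 3 + c ^ 3) ^ 3) (m : ℕ) :
    Module.finrank k ↥(Sklyanin.degComponent k a b c m) = (m + 1) * (m + 2) / 2 := by
  obtain ⟨ha, hb⟩ := mul_ne_zero_iff.1 (mul_ne_zero_iff.1 habc).1
  have hcubes : ¬(a ^ 3 = b ^ 3 ∧ b ^ 3 = c ^ 3) := fun h => hdeg (by
    rw [mul_pow, mul_pow, mul_pow, ← h.2, h.1]
    ring)
  have h := (isSklyanin_ringQuot a b c).finrank_pow ha hb hcubes m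
  rw [← span_prod_ofFn_eq_pow] at h
  exact h

end
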